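/- arXiv:1102.1764 — 8 statements merged into one kernel-verified Lean document; each statement's English description precedes it below -/
import Mathlib

section
/- If F is a non-bipartite-agreeing family of graphs on 8 vertices, then |F| ≤ 2^(28−3) = 2^25, with equality if and only if F is a triangulumvirate, i.e., there exist a triangle T (the three edges on some three distinct vertices) and a subset T0 ⊆ T such that F = {G : G ∩ T = T0}. -/
/-- The edge set of the complete graph on `n` vertices. -/
abbrev Edge (n : ℕ) := {e : Sym2 (Fin n) // ¬ e.IsDiag}

/-- Graphs on `n` vertices, identified with their (indicator functions of) edge sets;
they form a vector space over `ZMod 2` under symmetric difference. -/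
abbrev Kvecsp (n : ℕ) := Edge n → ZMod 2

/-- The edge joining two distinct vertices. -/
def edg {n : ℕ} (u v : Fin n) (h : u ≠ v) : Edge n :=
  ⟨s(u, v), fun hd => h (Sym2.mk_isDiag_iff.mp hd)⟩

/-- Adjacency in a graph. -/
def KAdj {n : ℕ} (G : Kvecsp n) (u v : Fin n) : Prop :=
  ∃ h : u ≠ v, G (edg u v h) = 1

/-- The complement of a graph. -/
def Kcompl {n : ℕ} (G : Kvecsp n) : Kvecsp n := fun e => G e + 1

/-- The agreement of two graphs: the complement of their symmetric difference. -/
def agr {n : ℕ} (G₁ G₂ : Kvecsp n) : Kvecsp n := fun e => G₁ e + G₂ e + 1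

/-- A graph is bipartite if its vertices can be split in two parts with all edges crossing. -/
def IsBipartite {n : ℕ} (G : Kvecsp n) : Prop :=
  ∃ s : Set (Fin n), ∀ u v : Fin n, KAdj G u v → (u ∈ s ↔ v ∉ s)

/-- A graph contains a triangle. -/
def HasTriangle {n : ℕ} (G : Kvecsp n) : Prop :=
  ∃ u v w : Fin n, u ≠ v ∧ u ≠ w ∧ v ≠ w ∧ KAdj G u v ∧ KAdj G u w ∧ KAdj G v w

/-- A graph is triangle-free. -/
def TriangleFree {n : ℕ} (G : Kvecsp n) : Prop := ¬ HasTriangle G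

/-- A family of graphs is non-bipartite-agreeing if the agreement of any two members
is not bipartite. -/
def NonBipartiteAgreeing {n : ℕ} (F : Finset (Kvecsp n)) : Prop :=
  ∀ G₁ ∈ F, ∀ G₂ ∈ F, ¬ IsBipartite (agr G₁ G₂)

/-- The seven lines of the Fano plane, as bit masks. -/
def LM : List ℕ := [7, 25, 97, 42, 82, 76, 52]

/-- An eight-word linear code all of whose nonzero words contain a line. -/
def KC : List ℕ := [0, 29, 43, 54, 71, 90, 108, 113]

/-- Representatives of the nontrivial cosets of `KC`, in search order. -/
def reps : List ℕ := [6, 9, 13, 5, 15, 2, 14, 12, 11, 3, 7, 4, 8, 1, 10]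

/-- Fifteen one-factorizations of the complete graph of affine type; for each of them,
the seven lines with a position and the mask of compatible positions. -/
def SP : List (List ℕ × List (ℕ × ℕ × ℕ)) :=
[([134234145, 67633170, 34603020, 16910400, 8651904, 4235520, 2167296], [(7, 0,
   23955601894076776091276279824639), (25, 1, 1343900694689070134063733912447), (97, 2,
   23979780375140326070187830260607), (42, 3, 38104111690446455692049141075839), (82, 4,
   16374463823631605724445474164607), (76, 5, 38110726897024663215731023395967), (52, 6,
   16349124839998005674353022844031)]), ([67633185, 34603026, 134234124, 8462400, 16814208,
   2361600, 4326912], [(7, 7, 23955601894076776091276279840641), (25, 8,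
   32335581011777629368818465357726), (97, 9, 14448419846839358269185175699358), (42, 10,
   23896365231785942330070081716216), (82, 11, 5368299729238785634933030764536), (76, 12,
   14388796736789391345277562929126), (52, 13, 32622830337961637647226184286182)]), ([34603041,
   134234130, 67633164, 4460608, 2236544, 16844032, 8423936], [(7, 14,
   23955601894076776091276281888897), (25, 15, 27050445108511422807966067183462), (97, 16,
   9760009574777935311448221667174), (42, 17, 9549319395838338167183002041374), (82, 18,
   27124265649951466936801379220510), (76, 19, 23880854819602119568759346688888), (52, 20,
   10396077101725913732551790293880)]), ([134226177, 17825922, 67371076, 8914952, 33686544,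
   2179104, 4231680], [(7, 21, 14472518441152039929388421277131), (25, 22,
   32330626887147900900879747077835), (97, 23, 23979780375140326070188088210180), (42, 24,
   14373358957912159302077839140275), (82, 25, 5368299729238785634933263534200), (76, 26,
   23880854819602119568759544361848), (52, 27, 32623446801263403812794292950707)]), ([67371265,
   134226050, 17825860, 33624072, 8437776, 4719648, 2230784], [(7, 28,
   14472518441152039929421979903435), (25, 29, 710082436998864399282247263701), (97, 30,
   14448419846839358269218193244702), (42, 31, 38103950397162556541052520683989), (82, 32,
   27124265649951466936831173737502), (76, 33, 38110726897024663215756524764192), (52, 34,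
   27149684691119351494674561587659)]), ([17826049, 67371138, 134225988, 4341768, 2625552,
   33589280, 8455680], [(7, 35, 14472518441152039933717484070347), (25, 36,
   16289801943314502029146680650413), (97, 37, 9760009574777935315674467471206), (42, 38,
   9529514533672020529209695595211), (82, 39, 16374463823631605728259405123344), (76, 40,
   14388796736789391348541738061926), (52, 41, 20537288764143656555483719591341)]), ([134222337,
   33818626, 17302532, 67240072, 9437264, 4243488, 2171136], [(7, 42,
   27064722426649073896888845691571), (25, 43, 9759973404594780916590750521779), (97, 44,
   23979780375140326611147551126276), (42, 45, 9529514533672021048488421550795), (82, 46,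
   23896365231785942818253244433528), (76, 47, 10396077101725914150366207816568), (52, 48,
   27149684691119351771734580353483)]), ([33820673, 17303554, 134219268, 8470536, 67141904,
   3145888, 4333632], [(7, 49, 27064722426649144274429116377779), (25, 50,
   710082436998934767992870495701), (97, 51, 27050445108511492050810335956838), (42, 52,
   14373358957912226293122046715315), (82, 53, 38104111690446518179493970841352), (76, 54,
   14388796736789444825523137941606), (52, 55, 38189957112840076003256200162005)]), ([17305601,
   134220290, 33817604, 5243144, 2244624, 67174496, 8429696], [(7, 56,
   27064722426658152599583764212403), (25, 57, 16289801943323509224106454346413), (97, 58,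
   32335581011786492452885130477854), (42, 59, 2833005237896312439192595158701), (82, 60,
   27124265649959465329739587402782), (76, 61, 16349124840004851145786625997888), (52, 62,
   32623446801267943441218550290099)]), ([67240449, 16859138, 33595396, 9437320, 134221904,
   2623520, 4457728], [(7, 63, 16275604049034126116141101570477), (25, 64,
   9759973405747701871441783609779), (97, 65, 14448419847973833029718313107998), (42, 66,
   14373358959009740574463307900339), (82, 67, 9549319396862132463273880206366), (76, 68,
   16349124840874226017854226545728), (52, 69, 20537288764724728991640906950061)]), ([33693697,
   67174914, 16826372, 134220040, 8913936, 5242976, 2363520], [(7, 70,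
   16275604196626525449891224050093), (25, 71, 32330627034721853490555897861835), (97, 72,
   27050445253724192156207655456614), (42, 73, 2833005378378140450874026841773), (82, 74,
   16374463954677275624078128844560), (76, 75, 32622830450117841615380258103398), (52, 76,
   27149684765496623599854562269643)]), ([16924673, 33628162, 67142148, 4722696, 3146000,
   134218912, 8652864], [(7, 77, 16275623088453640169906901440941), (25, 78,
   16289820832780433503432568138413), (97, 79, 1343919281923546708987295019778), (42, 80,
   38103968379934123308629550619093), (82, 81, 23896382005631689483049880749176), (76, 82,
   23880869175596227492480794768248), (52, 83, 38189966633130870002613885430485)]), ([9437697,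
   4726786, 2375684, 134221960, 67240016, 33621024, 16812288], [(7, 84,
   321852875072225228959442065109), (25, 85, 9762391256234009625184348985779), (97, 86,
   9762388740790936901664041406310), (42, 87, 38106252191923102794969217423829), (82, 88,
   38106258742702091273463419244296), (76, 89, 32624667905207451883571737665638), (52, 90,
   32624665398489575359002264655539)]), ([8921089, 4472834, 3146244, 33687560, 134219024,
   67141792, 16846912], [(7, 91, 631376570519797965817813718741), (25, 92,
   32640111896969245969604265989835), (97, 93, 32640114261441832916443649900830), (42, 94,
   9824144263021941030546878294731), (82, 95, 9824142084559692588210605669406), (76, 96,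
   38345935504488885467961856998432), (52, 97, 38345937557789998452046424271573)]), ([8667137,
   5243394, 2629636, 67174664, 33591312, 134219872, 16909440], [(7, 98,
   40250409587809108283689385383637), (25, 99, 40324163694131033196020667999701), (97, 100,
   40324156651707124230087357477634), (42, 101, 40545610594677562280029002094253), (82, 102,
   40545603885572151526466544699512), (76, 103, 40502778857146362018098490389368), (52, 104,
   40502785717738269626892131558829)])]

/-- Complements of complete bipartite graphs, with one side of the bipartition. -/
def NC : List (ℕ × ℕ) :=
[(236470335, 15), (219423175, 23), (185343495, 39), (117694983, 71), (16540167, 135), (210899673,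
   27), (176827673, 43), (109433113, 75), (24793369, 139), (159796449, 51), (92909793, 83),
   (41300193, 147), (59871009, 99), (74321697, 163), (140636961, 195), (206637930, 29),
   (172569770, 45), (105302186, 77), (28919978, 141), (155538770, 53), (88779090, 85), (45427026,
   149), (55744146, 101), (78452370, 165), (144894610, 197), (147023436, 57), (80517708, 89),
   (53680716, 153), (47490444, 105), (86713740, 169), (153409932, 201), (30983284, 113),
   (103236724, 177), (170440820, 209), (204507060, 225), (244994329, 11), (240732330, 13),
   (238601332, 14)]

def gens : List ℕ :=
[134221960, 67240072, 9437320, 134220040, 33687560, 8914952, 67174664, 8470536, 5243144,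
   134221904, 134219872, 16910400, 8652864, 8462400, 134219024, 8455680, 67141904, 3146000]

/-- Elimination data for the three edges of the base triangle. -/
def elimT : List (ℕ × ℕ × List (ℕ × ℕ)) :=
[(0, 244994329, [(3, 3146), (4, 3659), (8, 2114), (12, 2123), (14, 1420), (17, 2048), (19, 1324),
   (20, 1288), (23, 2374), (25, 1114), (26, 1096), (27, 1024)]), (1, 240732330, [(3, 2568), (5,
   3584), (7, 2057), (11, 2048), (14, 707), (16, 2123), (19, 552), (20, 517), (22, 2317), (25,
   536), (26, 515), (27, 512)]), (2, 238601332, [(4, 2561), (5, 3073), (6, 2048), (10, 18944),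
   (14, 128), (15, 68099), (19, 32), (20, 4), (21, 133637), (25, 16), (26, 2), (27, 1)])]

/-- Witnesses for the constancy of the triangle. -/
def conT : List (ℕ × List (ℕ × ℕ × ℕ × ℕ)) :=
[(134221960, [(0, 40, 0, 2), (0, 40, 12, 4), (5, 96, 5, 1), (3, 32, 3, 20)]), (67240072, [(0, 96,
   0, 1), (0, 96, 6, 4), (11, 80, 11, 2), (3, 24, 10, 36)]), (9437320, [(0, 32, 8, 4), (0, 40, 0,
   2), (3, 96, 3, 1), (3, 16, 3, 36)]), (134220040, [(0, 80, 0, 2), (0, 80, 10, 4), (7, 96, 7, 1),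
   (3, 16, 3, 66)]), (33687560, [(0, 48, 4, 4), (0, 80, 0, 2), (6, 96, 6, 1), (6, 16, 6, 36)]),
   (8914952, [(0, 96, 0, 1), (0, 96, 3, 4), (14, 80, 14, 2), (6, 24, 12, 36)]), (67174664, [(0,
   24, 0, 1), (0, 24, 14, 4), (3, 80, 3, 2), (3, 40, 9, 20)]), (8470536, [(0, 40, 0, 2), (0, 40,
   7, 4), (10, 96, 10, 1), (3, 16, 3, 66)]), (5243144, [(0, 16, 9, 4), (0, 24, 0, 1), (5, 80, 5,
   2), (3, 48, 6, 5)]), (134221904, [(0, 48, 0, 4), (0, 48, 9, 2), (4, 96, 4, 1), (3, 32, 3,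
   10)]), (134219872, [(0, 16, 11, 1), (0, 48, 0, 4), (5, 80, 5, 2), (3, 16, 3, 66)]), (16910400,
   [(0, 16, 0, 1), (0, 32, 0, 2), (3, 24, 10, 66), (3, 32, 3, 65), (6, 24, 9, 68)]), (8652864,
   [(0, 96, 0, 1), (0, 96, 0, 6), (3, 16, 3, 66), (3, 32, 3, 65), (6, 8, 6, 68)]), (8462400, [(1,
   16, 1, 1), (1, 32, 1, 2), (3, 16, 3, 66), (3, 40, 9, 65), (6, 8, 6, 34)]), (134219024, [(0, 72,
   0, 4), (0, 72, 13, 2), (8, 96, 8, 1), (3, 8, 3, 68)]), (8455680, [(0, 40, 0, 2), (0, 40, 0, 5),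
   (5, 8, 5, 4), (11, 24, 11, 1)]), (67141904, [(0, 8, 12, 2), (0, 24, 0, 1), (4, 72, 4, 4), (3,
   40, 6, 3)]), (3146000, [(0, 24, 0, 1), (0, 24, 11, 2), (3, 72, 3, 4), (3, 40, 7, 68)])]

/-- Perfect matchings avoiding the base triangle which separate it from all others. -/
def RM : List ℕ := [2167296, 4235520, 134218912, 2244624]

/-- The sum (symmetric difference) of the members of a list selected by a bit mask. -/
def comb : List ℕ → ℕ → ℕ
  | [], _ => 0
  | p :: ps, I => (if I.testBit 0 then p else 0) ^^^ comb ps (I >>> 1)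

def okd (d : ℕ) : Bool := LM.all fun l => d &&& l != l

def loc : List ℕ → List ℕ → Bool
  | [], ch => LM.any fun l => (List.range 128).all fun I => I &&& l != 0 || ch.contains I
  | r :: rs, ch => KC.all fun k => (ch.any fun J => !okd (r ^^^ k ^^^ J)) || loc rs ((r ^^^ k) :: ch)

theorem loc_check : loc reps [0] = true := by decide +kernel

/-- Mask of the matchings of `A` meeting `T`. -/
def Lm : List ℕ → ℕ → ℕ
  | [], _ => 0
  | p :: ps, T => (if p &&& T == 0 then 0 else 1) + 2 * Lm ps T

def pairs : List ℕ := [3, 5, 6, 9, 10, 12, 17, 18, 20, 24, 33, 34, 36, 40, 48,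
  65, 66, 68, 72, 80, 96]

def badB (d : ℕ) : Bool := NC.any fun z => d &&& z.1 == z.1

def wit (cx : ℕ) (A : List ℕ) (L : ℕ) : Bool :=
  pairs.any fun I => I &&& L == 0 && badB (cx ^^^ comb A I)

theorem wit_check : (SP.all fun a => a.2.all fun e => SP.all fun b => b.2.all fun e' =>
    e.2.2.testBit e'.2.1 || wit (comb a.1 (127 ^^^ e.1)) b.1 e'.1) = true := by decide +kernel

def tri : List (Fin 8 × Fin 8 × Fin 8) :=
  (List.finRange 8).flatMap fun a => (List.finRange 8).flatMap fun b =>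
    ((List.finRange 8).filter fun c => a < b && b < c).map fun c => (a, b, c)

def idxF (u v : Fin 8) : ℕ := (max u.1 v.1) * (max u.1 v.1 - 1) / 2 + min u.1 v.1

def tmask (t : Fin 8 × Fin 8 × Fin 8) : ℕ :=
  (1 <<< idxF t.1 t.2.1) ||| (1 <<< idxF t.1 t.2.2) ||| (1 <<< idxF t.2.1 t.2.2)

def tmasks : List ℕ := tri.map tmask

def sp : List (List ℕ × List (ℕ × ℕ × ℕ)) → ℕ → List (List ℕ × ℕ) → Bool
  | [], _, acc => tmasks.any fun T => acc.all fun p => Lm p.1 T == p.2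
  | a :: rest, cand, acc => a.2.all fun e =>
      !cand.testBit e.2.1 || sp rest (cand &&& e.2.2) ((a.1, e.1) :: acc)

theorem sp_check : sp SP (2 ^ 105 - 1) [] = true := by decide +kernel

theorem comb_xor (A : List ℕ) : ∀ I J : ℕ, comb A (I ^^^ J) = comb A I ^^^ comb A J := by
  induction A with
  | nil => intro I J; simp [comb]
  | cons p ps ih =>
    intro I J
    simp only [comb, Nat.shiftRight_xor_distrib, ih, Nat.testBit_xor]
    have key : ∀ a b c d : ℕ, (a ^^^ b) ^^^ (c ^^^ d) = (a ^^^ c) ^^^ (b ^^^ d) := by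
      intros; ac_rfl
    rw [key]
    congr 1
    cases I.testBit 0 <;> cases J.testBit 0 <;> simp

theorem comb_zero (A : List ℕ) : comb A 0 = 0 := by
  have h := comb_xor A 0 0
  simpa using h

/-- The one-factorizations. -/
def As : List (List ℕ) := SP.map Prod.fst

theorem line_check : ∀ A ∈ As, ∀ d ∈ List.range 128, okd d = false → badB (comb A d) = true := by
  decide +kernel

theorem reps_lt : ∀ r ∈ reps, r < 128 := by decide +kernel
theorem KC_lt : ∀ r ∈ KC, r < 128 := by decide +kernel
theorem LM_compl : ∀ l ∈ LM, (127 ^^^ l) < 128 ∧ (127 ^^^ l) &&& l = 0 := by decide +kernel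
theorem pairs_lt : ∀ r ∈ pairs, r < 128 := by decide +kernel
theorem SP_lines : ∀ a ∈ SP, ∀ L ∈ LM, ∃ e ∈ a.2, e.1 = L := by decide +kernel
theorem SP_lines' : ∀ a ∈ SP, ∀ e ∈ a.2, e.1 ∈ LM ∧ e.2.1 < 105 := by decide +kernel

theorem xor_lt' {a b : ℕ} (ha : a < 128) (hb : b < 128) : a ^^^ b < 128 :=
  Nat.xor_lt_two_pow (n := 7) ha hb

theorem loc_sound (g : ℕ → Prop) (hg2 : ∀ r, ∃ k ∈ KC, g (r ^^^ k))
    (hg1 : ∀ I J, I < 128 → J < 128 → g I → g J → okd (I ^^^ J) = true) :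
    ∀ rs ch : List ℕ, (∀ r ∈ rs, r < 128) → (∀ J ∈ ch, g J ∧ J < 128) → loc rs ch = true →
      ∃ L ∈ LM, ∀ I < 128, I &&& L = 0 → g I := by
  intro rs
  induction rs with
  | nil =>
    intro ch _ hch h
    simp only [loc, List.any_eq_true, List.all_eq_true, List.mem_range, Bool.or_eq_true, bne_iff_ne,
      List.contains_iff_mem] at h
    obtain ⟨L, hL, h⟩ := h
    refine ⟨L, hL, fun I hI h0 => ?_⟩
    rcases h I hI with h | h
    · exact absurd h0 h
    · exact (hch I h).1
  | cons r rs ih =>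
    intro ch hrs hch h
    obtain ⟨k, hk, hg⟩ := hg2 r
    simp only [loc, List.all_eq_true] at h
    have h := h k hk
    have hlt : r ^^^ k < 128 := xor_lt' (hrs r (by simp)) (KC_lt k hk)
    simp only [Bool.or_eq_true, List.any_eq_true, Bool.not_eq_true'] at h
    rcases h with ⟨J, hJ, h⟩ | h
    · have := hg1 _ _ hlt (hch J hJ).2 hg (hch J hJ).1
      simp [this] at h
    · refine ih _ (fun q hq => hrs q (by simp [hq])) ?_ h
      intro J hJ
      rcases List.mem_cons.1 hJ with rfl | hJ
      · exact ⟨hg, hlt⟩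
      · exact hch J hJ

/-- The two properties of an extremal family used in the argument. -/
structure Extr (f : ℕ → Prop) : Prop where
  h1 : ∀ a b, f a → f b → badB (a ^^^ b) = false
  h2 : ∀ A ∈ As, ∀ a, ∃ k ∈ KC, f (a ^^^ comb A k)

def Good (f : ℕ → Prop) (x : ℕ) (A : List ℕ) (L : ℕ) : Prop :=
  ∀ I < 128, I &&& L = 0 → f (x ^^^ comb A I)

def HasT (f : ℕ → Prop) (x T : ℕ) : Prop := ∀ A ∈ As, Good f x A (Lm A T)

theorem xor_shift (x a b : ℕ) : (x ^^^ a) ^^^ (x ^^^ b) = a ^^^ b := by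
  rw [show (x ^^^ a) ^^^ (x ^^^ b) = (x ^^^ x) ^^^ (a ^^^ b) by ac_rfl]
  simp

theorem local_good {f : ℕ → Prop} (hf : Extr f) {x : ℕ} (hx : f x) {A : List ℕ} (hA : A ∈ As) :
    ∃ L ∈ LM, Good f x A L := by
  refine loc_sound (fun I => f (x ^^^ comb A I)) ?_ ?_ reps [0] reps_lt ?_ loc_check
  · intro r
    obtain ⟨k, hk, h⟩ := hf.h2 A hA (x ^^^ comb A r)
    refine ⟨k, hk, ?_⟩
    rw [comb_xor, ← Nat.xor_assoc]
    exact h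
  · intro I J hI hJ h h'
    by_contra hc
    have h3 := line_check A hA (I ^^^ J) (List.mem_range.2 (xor_lt' hI hJ)) (by simpa using hc)
    have h4 := hf.h1 _ _ h h'
    rw [xor_shift, ← comb_xor, h3] at h4
    exact absurd h4 (by simp)
  · intro J hJ
    have : J = 0 := by simpa using hJ
    subst this
    simp only [comb_zero, Nat.xor_zero]
    exact ⟨hx, by norm_num⟩

theorem compat {f : ℕ → Prop} (hf : Extr f) {x : ℕ} {a b : List ℕ × List (ℕ × ℕ × ℕ)}
    (ha : a ∈ SP) (hb : b ∈ SP) {e e' : ℕ × ℕ × ℕ} (he : e ∈ a.2) (he' : e' ∈ b.2)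
    (h : Good f x a.1 e.1) (h' : Good f x b.1 e'.1) : e.2.2.testBit e'.2.1 = true := by
  have hw := wit_check
  rw [List.all_eq_true] at hw
  have hw := hw a ha
  rw [List.all_eq_true] at hw
  have hw := hw e he
  rw [List.all_eq_true] at hw
  have hw := hw b hb
  rw [List.all_eq_true] at hw
  have hw := hw e' he'
  rw [Bool.or_eq_true] at hw
  rcases hw with hw | hw
  · exact hw
  · exfalso
    simp only [wit, List.any_eq_true, Bool.and_eq_true, beq_iff_eq] at hw
    obtain ⟨I, hI, h0, hbad⟩ := hw
    have hl := LM_compl e.1 (SP_lines' a ha e he).1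
    have h4 := hf.h1 _ _ (h _ hl.1 hl.2) (h' I (pairs_lt I hI) h0)
    rw [xor_shift, hbad] at h4
    exact absurd h4 (by simp)

theorem sp_sound {f : ℕ → Prop} (hf : Extr f) {x : ℕ} (hx : f x) :
    ∀ (rest : List (List ℕ × List (ℕ × ℕ × ℕ))) (cand : ℕ) (acc : List (List ℕ × ℕ)),
      (∀ a ∈ rest, a ∈ SP) →
      (∀ b ∈ SP, ∀ e ∈ b.2, Good f x b.1 e.1 → cand.testBit e.2.1 = true) →
      sp rest cand acc = true →
      ∃ T ∈ tmasks, (∀ p ∈ acc, Lm p.1 T = p.2) ∧ ∀ a ∈ rest, Good f x a.1 (Lm a.1 T) := by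
  intro rest
  induction rest with
  | nil =>
    intro cand acc _ _ h
    simp only [sp, List.any_eq_true, List.all_eq_true, beq_iff_eq] at h
    obtain ⟨T, hT, h⟩ := h
    exact ⟨T, hT, h, by simp⟩
  | cons a rest ih =>
    intro cand acc hr hc h
    have ha : a ∈ SP := hr a (by simp)
    obtain ⟨L, hL, hg⟩ := local_good hf hx (List.mem_map_of_mem (f := Prod.fst) ha)
    obtain ⟨e, he, rfl⟩ := SP_lines a ha L hL
    simp only [sp, List.all_eq_true] at h
    have h := h e he
    rw [hc a ha e he hg] at h
    simp only [Bool.not_true, Bool.false_or] at h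
    obtain ⟨T, hT, h1, h2⟩ := ih _ _ (fun b hb => hr b (by simp [hb])) (by
      intro b hb e' he' hg'
      rw [Nat.testBit_and, hc b hb e' he' hg', compat hf ha hb he he' hg hg']
      rfl) h
    have h3 : Lm a.1 T = e.1 := h1 (a.1, e.1) (by simp)
    refine ⟨T, hT, fun p hp => h1 p (by simp [hp]), ?_⟩
    intro b hb
    rcases List.mem_cons.1 hb with rfl | hb
    · rw [h3]; exact hg
    · exact h2 b hb

theorem exists_T {f : ℕ → Prop} (hf : Extr f) {x : ℕ} (hx : f x) : ∃ T ∈ tmasks, HasT f x T := by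
  obtain ⟨T, hT, -, h⟩ := sp_sound hf hx SP _ [] (fun a h => h) (by
    intro b hb e he _
    rw [Nat.testBit_two_pow_sub_one]
    simpa using (SP_lines' b hb e he).2) sp_check
  refine ⟨T, hT, ?_⟩
  intro A hA
  obtain ⟨a, ha, rfl⟩ := List.mem_map.1 hA
  exact h a ha

def Ag (i : ℕ) : List ℕ := As.getD i []

theorem gens_check : ∀ P ∈ gens, ∃ A ∈ As, ∃ c ∈ List.range 7, (1 <<< c) &&& Lm A 7 = 0 ∧
    comb A (1 <<< c) = P := by decide +kernel

theorem con_check : ∀ P ∈ gens, ∃ q ∈ conT, q.1 = P ∧ ∀ T ∈ tmasks, T ≠ 7 → ∃ r ∈ q.2,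
    Ag r.1 ∈ As ∧ r.2.1 < 128 ∧ r.2.1 &&& Lm (Ag r.1) 7 = 0 ∧ Ag r.2.2.1 ∈ As ∧ r.2.2.2 < 128 ∧
    r.2.2.2 &&& Lm (Ag r.2.2.1) T = 0 ∧
    badB (P ^^^ comb (Ag r.1) r.2.1 ^^^ comb (Ag r.2.2.1) r.2.2.2) = true := by decide +kernel

theorem shift_lt {c : ℕ} (hc : c ∈ List.range 7) : 1 <<< c < 128 := by
  have : c < 7 := List.mem_range.1 hc
  interval_cases c <;> decide

theorem const_gen {f : ℕ → Prop} (hf : Extr f) {x : ℕ} (h : HasT f x 7) {P : ℕ} (hP : P ∈ gens) :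
    HasT f (x ^^^ P) 7 := by
  obtain ⟨A, hA, c, hc, h0, hAP⟩ := gens_check P hP
  have hx : f (x ^^^ P) := by
    rw [← hAP]
    exact h A hA _ (shift_lt hc) h0
  obtain ⟨T, hT, hh⟩ := exists_T hf hx
  by_cases h7 : T = 7
  · rwa [h7] at hh
  · exfalso
    obtain ⟨q, hq, -, hq2⟩ := con_check P hP
    obtain ⟨r, -, h1, h2, h3, h4, h5, h6, hbad⟩ := hq2 T hT h7
    have h8 := hf.h1 _ _ (h _ h1 _ h2 h3) (hh _ h4 _ h5 h6)
    rw [show x ^^^ comb (Ag r.1) r.2.1 ^^^ (x ^^^ P ^^^ comb (Ag r.2.2.1) r.2.2.2)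
      = (x ^^^ x) ^^^ (P ^^^ comb (Ag r.1) r.2.1 ^^^ comb (Ag r.2.2.1) r.2.2.2) by ac_rfl,
      Nat.xor_self, Nat.zero_xor, hbad] at h8
    exact absurd h8 (by simp)

theorem const_comb {f : ℕ → Prop} (hf : Extr f) : ∀ (l : List ℕ), (∀ P ∈ l, P ∈ gens) →
    ∀ (m x : ℕ), HasT f x 7 → HasT f (x ^^^ comb l m) 7 := by
  intro l
  induction l with
  | nil => intro _ m x h; simpa [comb] using h
  | cons p ps ih =>
    intro hl m x h
    simp only [comb]
    rw [← Nat.xor_assoc]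
    apply ih (fun P hP => hl P (by simp [hP]))
    split_ifs
    · exact const_gen hf h (hl p (by simp))
    · simpa using h

theorem HasT.mem {f : ℕ → Prop} {x T : ℕ} (h : HasT f x T) : f x := by
  have h1 : Ag 0 ∈ As := by decide +kernel
  have := h _ h1 0 (by norm_num) (by simp)
  simpa [comb_zero] using this

def elok : List (ℕ × ℕ) → List ℕ → Bool
  | [], _ => true
  | r :: rs, D => (comb gens r.2).testBit r.1 && (D.all fun q => !(comb gens r.2).testBit q) &&
      elok rs (r.1 :: D)

theorem elim_check : ∀ t ∈ elimT, elok t.2.2 [t.1] = true ∧ t.2.1 < 2 ^ 28 ∧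
    (∀ q ∈ List.range 28, t.2.1.testBit q = true → q = t.1 ∨ ∃ r ∈ t.2.2, r.1 = q) ∧
    ∃ z ∈ NC, z.1 = t.2.1 := by decide +kernel

theorem elim_sound : ∀ (rows : List (ℕ × ℕ)) (D : List ℕ) (d : ℕ), elok rows D = true →
    (∀ q ∈ D, d.testBit q = true) → ∃ m, (∀ q ∈ D, (d ^^^ comb gens m).testBit q = true) ∧
      ∀ r ∈ rows, (d ^^^ comb gens m).testBit r.1 = true := by
  intro rows
  induction rows with
  | nil => intro D d _ h; exact ⟨0, by simpa [comb_zero] using h, by simp⟩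
  | cons r rs ih =>
    intro D d h hD
    simp only [elok, Bool.and_eq_true, List.all_eq_true, Bool.not_eq_true'] at h
    obtain ⟨⟨h1, h2⟩, h3⟩ := h
    by_cases hp : d.testBit r.1 = true
    · obtain ⟨m, hm1, hm2⟩ := ih (r.1 :: D) d h3 (by
        intro q hq
        rcases List.mem_cons.1 hq with rfl | hq
        · exact hp
        · exact hD q hq)
      refine ⟨m, fun q hq => hm1 q (by simp [hq]), fun s hs => ?_⟩
      rcases List.mem_cons.1 hs with rfl | hs
      · exact hm1 _ (by simp)
      · exact hm2 s hs
    · obtain ⟨m, hm1, hm2⟩ := ih (r.1 :: D) (d ^^^ comb gens r.2) h3 (by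
        intro q hq
        rcases List.mem_cons.1 hq with rfl | hq
        · rw [Nat.testBit_xor, h1]; simpa using hp
        · rw [Nat.testBit_xor, h2 q hq, hD q hq]; rfl)
      refine ⟨r.2 ^^^ m, ?_, ?_⟩
      · intro q hq
        rw [comb_xor, ← Nat.xor_assoc]
        exact hm1 q (by simp [hq])
      · intro s hs
        rw [comb_xor, ← Nat.xor_assoc]
        rcases List.mem_cons.1 hs with rfl | hs
        · exact hm1 _ (by simp)
        · exact hm2 s hs

theorem agree {f : ℕ → Prop} (hf : Extr f) {x y : ℕ} (h : HasT f x 7) (hy : f y)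
    {t : ℕ × ℕ × List (ℕ × ℕ)} (ht : t ∈ elimT) : (x ^^^ y).testBit t.1 = false := by
  by_contra hc
  have hc : (x ^^^ y).testBit t.1 = true := by simpa using hc
  obtain ⟨h1, h2, h3, z, hz, h4⟩ := elim_check t ht
  obtain ⟨m, hm1, hm2⟩ := elim_sound t.2.2 [t.1] (x ^^^ y) h1 (by
    intro q hq
    rw [List.mem_singleton] at hq
    rw [hq]; exact hc)
  have hfm := (const_comb hf gens (fun _ h => h) m x h).mem
  have hb := hf.h1 _ _ hfm hy
  have : badB (x ^^^ comb gens m ^^^ y) = true := by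
    rw [show x ^^^ comb gens m ^^^ y = x ^^^ y ^^^ comb gens m by ac_rfl]
    simp only [badB, List.any_eq_true, beq_iff_eq]
    refine ⟨z, hz, ?_⟩
    apply Nat.eq_of_testBit_eq
    intro q
    rw [Nat.testBit_and, h4]
    by_cases hq : t.2.1.testBit q = true
    · have hq28 : q < 28 := by
        by_contra hlt
        rw [Nat.testBit_lt_two_pow (lt_of_lt_of_le h2 (Nat.pow_le_pow_right (by norm_num)
          (not_lt.1 hlt)))] at hq
        exact absurd hq (by simp)
      have : (x ^^^ y ^^^ comb gens m).testBit q = true := by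
        rcases h3 q (List.mem_range.2 hq28) hq with rfl | ⟨r, hr, rfl⟩
        · exact hm1 _ (by simp)
        · exact hm2 r hr
      rw [this, hq]; rfl
    · have hq : t.2.1.testBit q = false := by simpa using hq
      rw [hq]; simp
  rw [this] at hb
  exact absurd hb (by simp)

theorem idxF_comm (u v : Fin 8) : idxF u v = idxF v u := by
  simp only [idxF, max_comm, min_comm]

def idxE : Sym2 (Fin 8) → ℕ := Sym2.lift ⟨idxF, idxF_comm⟩

/-- The graph encoded by a natural number, relative to a relabelling of the vertices. -/
def Phi (σ : Equiv.Perm (Fin 8)) (n : ℕ) : Kvecsp 8 :=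
  fun e => if n.testBit (idxE (e.1.map σ)) then 1 else 0

theorem Phi_edg (σ : Equiv.Perm (Fin 8)) (n : ℕ) (u v : Fin 8) (h : u ≠ v) :
    Phi σ n (edg u v h) = if n.testBit (idxF (σ u) (σ v)) then 1 else 0 := rfl

theorem Phi_xor (σ : Equiv.Perm (Fin 8)) (a b : ℕ) : Phi σ (a ^^^ b) = Phi σ a + Phi σ b := by
  funext e
  simp only [Phi, Pi.add_apply, Nat.testBit_xor]
  cases a.testBit (idxE (e.1.map σ)) <;> cases b.testBit (idxE (e.1.map σ)) <;> decide

theorem idxF_lt : ∀ u v : Fin 8, u ≠ v → idxF u v < 28 := by decide +kernel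

theorem idxF_inj : ∀ u v u' v' : Fin 8, u ≠ v → u' ≠ v' → idxF u v = idxF u' v' →
    (u = u' ∧ v = v') ∨ (u = v' ∧ v = u') := by decide +kernel

theorem edge_cases (e : Edge 8) : ∃ (u v : Fin 8) (h : u ≠ v), e = edg u v h := by
  obtain ⟨e, he⟩ := e
  induction e using Sym2.ind with
  | _ u v => exact ⟨u, v, fun h => he (Sym2.mk_isDiag_iff.2 h), rfl⟩

theorem Phi_surj (σ : Equiv.Perm (Fin 8)) (G : Kvecsp 8) : ∃ n, Phi σ n = G := by
  classical
  refine ⟨Nat.ofBits (fun i : Fin 28 => decide (∃ e : Edge 8, idxE (e.1.map σ) = i.1 ∧ G e = 1)), ?_⟩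
  funext e
  obtain ⟨u, v, h, rfl⟩ := edge_cases e
  have hs : σ u ≠ σ v := fun h' => h (σ.injective h')
  rw [Phi_edg, Nat.testBit_ofBits_lt _ _ (idxF_lt _ _ hs)]
  have key : (∃ e : Edge 8, idxE (e.1.map σ) = idxF (σ u) (σ v) ∧ G e = 1) ↔
      G (edg u v h) = 1 := by
    constructor
    · rintro ⟨e, h1, h2⟩
      obtain ⟨u', v', h', rfl⟩ := edge_cases e
      have h1 : idxF (σ u') (σ v') = idxF (σ u) (σ v) := h1
      have hs' : σ u' ≠ σ v' := fun hz => h' (σ.injective hz)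
      have : edg u' v' h' = edg u v h := by
        apply Subtype.ext
        change s(u', v') = s(u, v)
        rw [Sym2.eq_iff]
        rcases idxF_inj _ _ _ _ hs' hs h1 with ⟨ha, hb⟩ | ⟨ha, hb⟩
        · exact Or.inl ⟨σ.injective ha, σ.injective hb⟩
        · exact Or.inr ⟨σ.injective ha, σ.injective hb⟩
      rwa [← this]
    · intro h2
      exact ⟨edg u v h, rfl, h2⟩
  simp only [key, decide_eq_true_eq]
  have : ∀ z : ZMod 2, (if z = 1 then (1 : ZMod 2) else 0) = z := by decide
  exact this _

theorem NC_check : ∀ z ∈ NC, ∀ u v : Fin 8, u ≠ v → z.2.testBit u.1 = z.2.testBit v.1 →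
    z.1.testBit (idxF u v) = true := by decide +kernel

theorem bad_bip (σ : Equiv.Perm (Fin 8)) (a b : ℕ) (h : badB (a ^^^ b) = true) :
    IsBipartite (agr (Phi σ a) (Phi σ b)) := by
  simp only [badB, List.any_eq_true, beq_iff_eq] at h
  obtain ⟨z, hz, h⟩ := h
  refine ⟨{u | z.2.testBit (σ u).1 = true}, ?_⟩
  rintro u v ⟨huv, h1⟩
  have hs : σ u ≠ σ v := fun h' => huv (σ.injective h')
  have h2 : Phi σ (a ^^^ b) (edg u v huv) = 0 := by
    rw [Phi_xor]
    simpa [agr] using h1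
  have h3 : (a ^^^ b).testBit (idxF (σ u) (σ v)) = false := by
    rw [Phi_edg] at h2
    by_contra hc
    have hc : (a ^^^ b).testBit (idxF (σ u) (σ v)) = true := by simpa using hc
    rw [hc] at h2
    exact absurd h2 (by decide)
  have h4 : z.2.testBit (σ u).1 ≠ z.2.testBit (σ v).1 := by
    intro hc
    have h5 := NC_check z hz _ _ hs hc
    rw [← h, Nat.testBit_and, h3] at h5
    exact absurd h5 (by simp)
  simp only [Set.mem_ofPred_eq]
  revert h4
  cases z.2.testBit (σ u).1 <;> cases z.2.testBit (σ v).1 <;> simp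

section counting

variable {F : Finset (Kvecsp 8)} (σ : Equiv.Perm (Fin 8))

theorem notbad (hF : NonBipartiteAgreeing F) (a b : ℕ) (ha : Phi σ a ∈ F) (hb : Phi σ b ∈ F) :
    badB (a ^^^ b) = false := by
  by_contra hc
  exact hF _ ha _ hb (bad_bip σ a b (by simpa using hc))

theorem KC_check : ∀ A ∈ As, ∀ k ∈ KC, ∀ k' ∈ KC, k ≠ k' → badB (comb A (k ^^^ k')) = true := by
  decide +kernel

theorem add_self_K (G : Kvecsp 8) : G + G = 0 := by
  funext e
  exact CharTwo.add_self_eq_zero _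

theorem inj_K (hF : NonBipartiteAgreeing F) {A : List ℕ} (hA : A ∈ As) :
    Set.InjOn (fun p : Kvecsp 8 × ℕ => p.1 + Phi σ (comb A p.2))
      (F ×ˢ KC.toFinset : Finset (Kvecsp 8 × ℕ)) := by
  rintro ⟨G, k⟩ h ⟨G', k'⟩ h' heq
  simp only [Finset.coe_product, Set.mem_prod, Finset.mem_coe, List.mem_toFinset] at h h'
  simp only at heq
  by_cases hk : k = k'
  · subst hk
    rw [add_right_cancel heq]
  · exfalso
    obtain ⟨a, rfl⟩ := Phi_surj σ G
    have h1 : G' = Phi σ (a ^^^ comb A (k ^^^ k')) := by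
      rw [comb_xor, ← Nat.xor_assoc, Phi_xor, Phi_xor, heq, add_assoc, add_self_K, add_zero]
    have h2 := notbad σ hF a (a ^^^ comb A (k ^^^ k')) h.1 (h1 ▸ h'.1)
    rw [← Nat.xor_assoc, Nat.xor_self, Nat.zero_xor, KC_check A hA k h.2 k' h'.2 hk] at h2
    exact absurd h2 (by simp)

theorem card_Edge : Fintype.card (Edge 8) = 28 := by
  rw [Sym2.card_subtype_not_diag]
  rfl

theorem card_K : Fintype.card (Kvecsp 8) = 2 ^ 28 := by
  rw [Fintype.card_fun, card_Edge, ZMod.card]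

theorem card_KC : KC.toFinset.card = 8 := by decide +kernel

theorem Ag_zero : Ag 0 ∈ As := by decide +kernel

theorem upper (hF : NonBipartiteAgreeing F) : F.card ≤ 2 ^ 25 := by
  classical
  have h1 := Finset.card_image_of_injOn (inj_K 1 hF Ag_zero)
  have h2 := Finset.card_le_univ ((F ×ˢ KC.toFinset).image
    (fun p : Kvecsp 8 × ℕ => p.1 + Phi 1 (comb (Ag 0) p.2)))
  rw [h1, Finset.card_product, card_KC, card_K] at h2
  omega

theorem extr (hF : NonBipartiteAgreeing F) (hc : F.card = 2 ^ 25) :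
    Extr (fun n => Phi σ n ∈ F) := by
  classical
  refine ⟨notbad σ hF, ?_⟩
  intro A hA a
  have h1 := Finset.card_image_of_injOn (inj_K σ hF hA)
  rw [Finset.card_product, card_KC, hc, show 2 ^ 25 * 8 = 2 ^ 28 by norm_num, ← card_K] at h1
  have h2 := Finset.eq_univ_of_card _ h1
  have h3 := Finset.mem_univ (Phi σ a)
  rw [← h2, Finset.mem_image] at h3
  obtain ⟨⟨G, k⟩, hp, h3⟩ := h3
  rw [Finset.mem_product, List.mem_toFinset] at hp
  refine ⟨k, hp.2, ?_⟩
  rw [Phi_xor, ← h3, add_assoc, add_self_K, add_zero]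
  exact hp.1

end counting

/-- The relabelling sending a triangle to the base triangle. -/
def sig (t : Fin 8 × Fin 8 × Fin 8) : Equiv.Perm (Fin 8) :=
  Equiv.swap 2 t.2.2 * Equiv.swap 1 t.2.1 * Equiv.swap 0 t.1

theorem sig_check : ∀ t ∈ tri, ∀ P ∈ RM, ∃ A ∈ As, ∃ c ∈ List.range 7,
    (1 <<< c) &&& Lm A (tmask t) = 0 ∧ ∀ u v : Fin 8, u ≠ v →
      (comb A (1 <<< c)).testBit (idxF u v) = P.testBit (idxF (sig t u) (sig t v)) := by
  decide +kernel

theorem RM_check : ∀ T ∈ tmasks, T ≠ 7 → ∃ P ∈ RM, ∃ A ∈ As, 127 ^^^ Lm A T < 128 ∧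
    (127 ^^^ Lm A T) &&& Lm A T = 0 ∧ badB (P ^^^ comb A (127 ^^^ Lm A T)) = true := by
  decide +kernel

theorem elimT_cover : ∀ i ∈ [0, 1, 2], ∃ t ∈ elimT, t.1 = i := by decide +kernel

theorem exists_base {F : Finset (Kvecsp 8)} (hF : NonBipartiteAgreeing F)
    (hc : F.card = 2 ^ 25) : ∃ (σ : Equiv.Perm (Fin 8)) (y : ℕ),
      HasT (fun n => Phi σ n ∈ F) y 7 := by
  have hne : F.Nonempty := by
    rw [← Finset.card_pos, hc]; norm_num
  obtain ⟨G, hG⟩ := hne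
  obtain ⟨x, rfl⟩ := Phi_surj 1 G
  obtain ⟨T, hT, hx⟩ := exists_T (extr 1 hF hc) hG
  obtain ⟨t, ht, rfl⟩ := List.mem_map.1 hT
  obtain ⟨y, hy⟩ := Phi_surj (sig t) (Phi 1 x)
  refine ⟨sig t, y, ?_⟩
  have hRM : ∀ P ∈ RM, Phi (sig t) (y ^^^ P) ∈ F := by
    intro P hP
    obtain ⟨A, hA, c, hcc, h0, h1⟩ := sig_check t ht P hP
    have h2 : Phi (sig t) P = Phi 1 (comb A (1 <<< c)) := by
      funext e
      obtain ⟨u, v, h, rfl⟩ := edge_cases e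
      rw [Phi_edg, Phi_edg, ← h1 u v h]
      rfl
    rw [Phi_xor, hy, h2, ← Phi_xor]
    exact hx A hA _ (shift_lt hcc) h0
  have hyF : Phi (sig t) y ∈ F := hy ▸ hG
  have hE := extr (sig t) hF hc
  obtain ⟨T', hT', hy'⟩ := exists_T hE hyF
  by_cases h7 : T' = 7
  · rwa [h7] at hy'
  · exfalso
    obtain ⟨P, hP, A, hA, h1, h2, hbad⟩ := RM_check T' hT' h7
    have h3 := hE.h1 _ _ (hRM P hP) (hy' A hA _ h1 h2)
    rw [xor_shift, hbad] at h3
    exact absurd h3 (by simp)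

def Fam (T T₀ : Finset (Edge 8)) : Finset (Kvecsp 8) :=
  Finset.univ.filter (fun G : Kvecsp 8 => ∀ e ∈ T, (G e = 1 ↔ e ∈ T₀))

theorem mem_Fam (T T₀ : Finset (Edge 8)) (G : Kvecsp 8) :
    G ∈ Fam T T₀ ↔ ∀ e ∈ T, (G e = 1 ↔ e ∈ T₀) := by
  simp only [Fam, Finset.mem_filter, Finset.mem_univ, true_and]

theorem card_family (T T₀ : Finset (Edge 8)) (hT : T.card = 3) :
    (Fam T T₀).card = 2 ^ 25 := by
  have h : Fam T T₀ =
      Fintype.piFinset (fun e : Edge 8 =>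
        if e ∈ T then ({if e ∈ T₀ then 1 else 0} : Finset (ZMod 2)) else Finset.univ) := by
    ext G
    simp only [mem_Fam, Fintype.mem_piFinset]
    refine forall_congr' fun e => ?_
    by_cases he : e ∈ T
    · simp only [he, true_imp_iff, if_true, Finset.mem_singleton]
      have key : ∀ z : ZMod 2, ((z = 1 ↔ True) ↔ z = 1) ∧ ((z = 1 ↔ False) ↔ z = 0) := by decide
      by_cases h0 : e ∈ T₀
      · simp [h0]
      · simpa [h0] using (key (G e)).2
    · simp [he]
  rw [h, Fintype.card_piFinset]
  have h2 : ∀ e : Edge 8, (if e ∈ T then ({if e ∈ T₀ then 1 else 0} : Finset (ZMod 2))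
      else Finset.univ).card = if e ∈ T then 1 else 2 := by
    intro e
    split_ifs <;> simp [ZMod.card]
  simp only [h2]
  rw [Finset.prod_ite, Finset.prod_const_one, one_mul, Finset.prod_const]
  congr 1
  have h3 : Finset.univ.filter (fun e : Edge 8 => e ∉ T) = Tᶜ := by
    ext e; simp
  rw [h3, Finset.card_compl, hT, card_Edge]

theorem card_tri (u v w : Fin 8) (huv : u ≠ v) (huw : u ≠ w) (hvw : v ≠ w) :
    ({edg u v huv, edg u w huw, edg v w hvw} : Finset (Edge 8)).card = 3 := by
  rw [Finset.card_eq_three]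
  refine ⟨_, _, _, ?_, ?_, ?_, rfl⟩ <;>
  · intro h
    have h := congrArg Subtype.val h
    simp only [edg, Sym2.eq_iff] at h
    grind

/-- A non-bipartite-agreeing family of graphs on 8 vertices has at most `2^25` members,
with equality iff it is a triangulumvirate `{G : G ∩ T = T₀}` for some triangle `T`
and some `T₀ ⊆ T`. -/
theorem stmt0 (F : Finset (Kvecsp 8)) (hF : NonBipartiteAgreeing F) :
    F.card ≤ 2 ^ 25 ∧
    (F.card = 2 ^ 25 ↔
      ∃ (u v w : Fin 8) (huv : u ≠ v) (huw : u ≠ w) (hvw : v ≠ w)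
        (T₀ : Finset (Edge 8)),
        T₀ ⊆ {edg u v huv, edg u w huw, edg v w hvw} ∧
        ∀ G : Kvecsp 8, G ∈ F ↔
          ∀ e ∈ ({edg u v huv, edg u w huw, edg v w hvw} : Finset (Edge 8)),
            (G e = 1 ↔ e ∈ T₀)) := by
  refine ⟨upper hF, ?_, ?_⟩
  · intro hc
    obtain ⟨σ, y, hy⟩ := exists_base hF hc
    have hE := extr σ hF hc
    have hne : ∀ i j : Fin 8, i ≠ j → σ.symm i ≠ σ.symm j := fun i j h h' => h (σ.symm.injective h')
    have h01 := hne 0 1 (by decide)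
    have h02 := hne 0 2 (by decide)
    have h12 := hne 1 2 (by decide)
    have hag : ∀ i j : Fin 8, ∀ h : σ.symm i ≠ σ.symm j, idxF i j ∈ [0, 1, 2] →
        ∀ G ∈ F, G (edg _ _ h) = Phi σ y (edg _ _ h) := by
      intro i j h hij G hG
      obtain ⟨y', rfl⟩ := Phi_surj σ G
      obtain ⟨t, ht, hti⟩ := elimT_cover _ hij
      have h1 := agree hE hy hG ht
      rw [hti, Nat.testBit_xor] at h1
      rw [Phi_edg, Phi_edg]
      simp only [Equiv.apply_symm_apply]
      have h2 : y.testBit (idxF i j) = y'.testBit (idxF i j) := by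
        revert h1
        cases y.testBit (idxF i j) <;> cases y'.testBit (idxF i j) <;> simp
      rw [h2]
    refine ⟨σ.symm 0, σ.symm 1, σ.symm 2, h01, h02, h12,
      Finset.filter (fun e => Phi σ y e = 1)
        {edg _ _ h01, edg _ _ h02, edg _ _ h12}, Finset.filter_subset _ _, ?_⟩
    set T : Finset (Edge 8) := {edg _ _ h01, edg _ _ h02, edg _ _ h12} with hTdef
    set T₀ := Finset.filter (fun e => Phi σ y e = 1) T with hT₀
    have hsub : F ⊆ Fam T T₀ := by
      intro G hG
      rw [mem_Fam]
      intro e he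
      have h1 : G e = Phi σ y e := by
        have he' := he
        rw [hTdef, Finset.mem_insert, Finset.mem_insert, Finset.mem_singleton] at he'
        rcases he' with rfl | rfl | rfl
        · exact hag 0 1 h01 (by decide) G hG
        · exact hag 0 2 h02 (by decide) G hG
        · exact hag 1 2 h12 (by decide) G hG
      rw [hT₀, Finset.mem_filter, h1]
      exact ⟨fun h => ⟨he, h⟩, fun h => h.2⟩
    have hcard := card_family T T₀ (card_tri _ _ _ h01 h02 h12)
    have heq := Finset.eq_of_subset_of_card_le hsub (le_of_eq (hcard.trans hc.symm))
    intro G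
    rw [← mem_Fam, ← heq]
  · rintro ⟨u, v, w, huv, huw, hvw, T₀, -, h⟩
    have hcard := card_family _ T₀ (card_tri u v w huv huw hvw)
    rw [← hcard]
    congr 1
    ext G
    rw [h G, mem_Fam]
end

section
/- Let V be a three-dimensional linear subspace of the ZZ_2-vector space of graphs on n vertices (n ≥ 3) such that the complement of every nonzero element of V is a bipartite graph. Then every non-bipartite-agreeing family F of graphs on n vertices intersects each coset of V in at most one graph, and consequently |F| ≤ 2^(binomial(n,2) − 3). -/
/-- If `V` is a three-dimensional subspace of the space of graphs on `n ≥ 3` vertices all of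
whose nonzero elements have bipartite complement, then a non-bipartite-agreeing family meets
each coset of `V` in at most one graph, hence has at most `2^(C(n,2)-3)` members. -/
theorem stmt1 (n : ℕ) (hn : 3 ≤ n) (V : Submodule (ZMod 2) (Kvecsp n))
    (hdim : Module.finrank (ZMod 2) V = 3)
    (hbip : ∀ v ∈ V, v ≠ 0 → IsBipartite (Kcompl v))
    (F : Finset (Kvecsp n)) (hF : NonBipartiteAgreeing F) :
    (∀ G₁ ∈ F, ∀ G₂ ∈ F, G₁ - G₂ ∈ V → G₁ = G₂) ∧
    F.card ≤ 2 ^ (n.choose 2 - 3) := by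
  have h1 : ∀ G₁ ∈ F, ∀ G₂ ∈ F, G₁ - G₂ ∈ V → G₁ = G₂ := by
    intro G₁ h₁ G₂ h₂ h
    by_contra hne
    apply hF G₁ h₁ G₂ h₂
    have hb := hbip _ h (sub_ne_zero.mpr hne)
    have : agr G₁ G₂ = Kcompl (G₁ - G₂) := by
      funext e
      simp only [agr, Kcompl, Pi.sub_apply, CharTwo.sub_eq_add]
    rwa [this]
  refine ⟨h1, ?_⟩
  classical
  have hinj : Set.InjOn (V.mkQ) (F : Set (Kvecsp n)) := by
    intro a ha b hb hab
    exact h1 a ha b hb ((Submodule.Quotient.eq V).mp hab)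
  have hq : Module.finrank (ZMod 2) (Kvecsp n ⧸ V) = n.choose 2 - 3 := by
    have h := Submodule.finrank_quotient_add_finrank V
    have hE : Fintype.card (Edge n) = n.choose 2 := by
      have := Sym2.card_subtype_not_diag (α := Fin n)
      rw [Fintype.card_fin] at this
      rw [← this]
    rw [hdim, Module.finrank_fintype_fun_eq_card, hE] at h
    omega
  haveI : Finite (Kvecsp n ⧸ V) := Finite.of_surjective V.mkQ V.mkQ_surjective
  haveI := Fintype.ofFinite (Kvecsp n ⧸ V)
  have hc := Module.card_eq_pow_finrank (K := ZMod 2) (V := Kvecsp n ⧸ V)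
  rw [hq, ZMod.card] at hc
  rw [← hc, ← Finset.card_image_of_injOn hinj]
  exact Finset.card_le_univ _
end

section
/- There exists a three-dimensional linear subspace V of the ZZ_2-vector space of graphs on 8 vertices such that the complement of every nonzero element of V is a cube, i.e., is isomorphic as a graph to the 3-dimensional hypercube graph Q_3. -/
/-- A graph on 8 vertices is a cube if it is isomorphic to the 3-dimensional hypercube graph:
there is a relabelling of its vertices by `ZZ_2^3` under which adjacency is exactly
"differ in precisely one coordinate". -/
def IsCube (G : Kvecsp 8) : Prop :=
  ∃ f : Fin 8 ≃ (Fin 3 → ZMod 2), ∀ u v : Fin 8,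
    KAdj G u v ↔ (Finset.univ.filter fun j : Fin 3 => f u j ≠ f v j).card = 1

/-- Adjacency matrices of the three basis graphs. -/
def basisMat : Fin 3 → Fin 8 → Fin 8 → ZMod 2 :=
  ![![![0, 0, 0, 1, 0, 1, 1, 1],
    ![0, 0, 1, 0, 1, 0, 1, 1],
    ![0, 1, 0, 0, 1, 1, 0, 1],
    ![1, 0, 0, 0, 1, 1, 1, 0],
    ![0, 1, 1, 1, 0, 0, 0, 1],
    ![1, 0, 1, 1, 0, 0, 1, 0],
    ![1, 1, 0, 1, 0, 1, 0, 0],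
    ![1, 1, 1, 0, 1, 0, 0, 0]],
   ![![0, 0, 1, 0, 1, 1, 0, 1],
    ![0, 0, 0, 1, 1, 1, 1, 0],
    ![1, 0, 0, 0, 0, 1, 1, 1],
    ![0, 1, 0, 0, 1, 0, 1, 1],
    ![1, 1, 0, 1, 0, 0, 1, 0],
    ![1, 1, 1, 0, 0, 0, 0, 1],
    ![0, 1, 1, 1, 1, 0, 0, 0],
    ![1, 0, 1, 1, 0, 1, 0, 0]],
   ![![0, 1, 0, 0, 1, 1, 1, 0],
    ![1, 0, 0, 0, 1, 1, 0, 1],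
    ![0, 0, 0, 1, 1, 0, 1, 1],
    ![0, 0, 1, 0, 0, 1, 1, 1],
    ![1, 1, 1, 0, 0, 1, 0, 0],
    ![1, 1, 0, 1, 1, 0, 0, 0],
    ![1, 0, 1, 1, 0, 0, 0, 1],
    ![0, 1, 1, 1, 0, 0, 1, 0]]]

/-- For each nonzero combination `a`, encoded as a number, a cube labelling of the vertices. -/
def cubeLab : Fin 8 → Fin 8 → ℕ :=
  ![![0, 1, 2, 3, 4, 5, 6, 7],
    ![0, 1, 2, 3, 4, 5, 6, 7],
    ![0, 1, 3, 2, 7, 6, 4, 5],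
    ![0, 1, 6, 7, 3, 2, 5, 4],
    ![0, 3, 1, 2, 6, 5, 7, 4],
    ![0, 7, 1, 6, 5, 2, 4, 3],
    ![0, 6, 7, 1, 2, 4, 5, 3],
    ![0, 6, 3, 5, 1, 7, 2, 4]]

theorem basisMat_symm (i : Fin 3) (u v : Fin 8) : basisMat i u v = basisMat i v u := by
  revert i u v; decide

/-- The basis graphs. -/
def basisGraph (i : Fin 3) : Kvecsp 8 :=
  fun e => Sym2.lift ⟨basisMat i, basisMat_symm i⟩ e.1

theorem basisGraph_edg (i : Fin 3) (u v : Fin 8) (h : u ≠ v) :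
    basisGraph i (edg u v h) = basisMat i u v := rfl

/-- The vertex labelling by `ZZ_2^3` for the combination `k`. -/
def cubeFun (k : Fin 8) (u : Fin 8) : Fin 3 → ZMod 2 :=
  fun j => if Nat.testBit (cubeLab k u) j then 1 else 0

theorem cubeFun_injective (k : Fin 8) : Function.Injective (cubeFun k) := by
  have h : ∀ k u v : Fin 8, (∀ j, cubeFun k u j = cubeFun k v j) → u = v := by decide +kernel
  intro u v huv
  exact h k u v fun j => congrFun huv j

theorem cubeFun_bijective (k : Fin 8) : Function.Bijective (cubeFun k) :=
  (Fintype.bijective_iff_injective_and_card _).2 ⟨cubeFun_injective k, by simp [ZMod.card]⟩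

/-- The number encoding a combination. -/
def code (a b c : ZMod 2) : Fin 8 :=
  (if a = 1 then 1 else 0) + (if b = 1 then 2 else 0) + (if c = 1 then 4 else 0)

theorem key : ∀ a b c : ZMod 2, ¬ (a = 0 ∧ b = 0 ∧ c = 0) → ∀ u v : Fin 8,
    ((u ≠ v ∧ a * basisMat 0 u v + b * basisMat 1 u v + c * basisMat 2 u v + 1 = 1) ↔
      (Finset.univ.filter fun j : Fin 3 =>
        cubeFun (code a b c) u j ≠ cubeFun (code a b c) v j).card = 1) := by
  decide +kernel

theorem basisGraph_isCube (a : Fin 3 → ZMod 2) (ha : a ≠ 0) :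
    IsCube (Kcompl (∑ i, a i • basisGraph i)) := by
  have hne : ¬ (a 0 = 0 ∧ a 1 = 0 ∧ a 2 = 0) := by
    rintro ⟨h0, h1, h2⟩
    apply ha
    funext i
    fin_cases i <;> assumption
  refine ⟨Equiv.ofBijective _ (cubeFun_bijective (code (a 0) (a 1) (a 2))), fun u v => ?_⟩
  rw [Equiv.ofBijective_apply, Equiv.ofBijective_apply, ← key _ _ _ hne u v]
  unfold KAdj Kcompl
  simp only [Fin.sum_univ_three, Pi.add_apply, Pi.smul_apply, smul_eq_mul, basisGraph_edg]
  exact exists_prop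

theorem basisGraph_linearIndependent : LinearIndependent (ZMod 2) basisGraph := by
  rw [Fintype.linearIndependent_iff]
  intro a h
  by_contra hcon
  have ha : a ≠ 0 := fun h0 => hcon fun i => congrFun h0 i
  obtain ⟨f, hf⟩ := basisGraph_isCube a ha
  rw [h] at hf
  -- the complement of the empty graph is complete, which is not a cube
  have h1 : ∀ u v : Fin 8, u ≠ v → KAdj (Kcompl (0 : Kvecsp 8)) u v :=
    fun u v huv => ⟨huv, by simp [Kcompl]⟩
  have hd : (f.symm 0) ≠ f.symm 1 := fun h => by simpa using f.symm.injective h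
  have h2 := (hf _ _).1 (h1 _ _ hd)
  simp at h2

/-- There is a three-dimensional subspace of the space of graphs on 8 vertices all of whose
nonzero elements are complements of cubes. -/
theorem stmt3 : ∃ V : Submodule (ZMod 2) (Kvecsp 8),
    Module.finrank (ZMod 2) V = 3 ∧ ∀ v ∈ V, v ≠ 0 → IsCube (Kcompl v) := by
  refine ⟨Submodule.span (ZMod 2) (Set.range basisGraph), ?_, ?_⟩
  · simpa using finrank_span_eq_card basisGraph_linearIndependent
  · intro v hv hv0
    obtain ⟨a, rfl⟩ := (Submodule.mem_span_range_iff_exists_fun (ZMod 2)).1 hv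
    refine basisGraph_isCube a ?_
    rintro rfl
    exact hv0 (by simp)
end

section
/- Suppose V is a three-dimensional linear subspace of the ZZ_2-vector space of graphs on n vertices such that the complement of every nonzero element of V is triangle-free. Then n ≤ 8. -/
/-- Evaluation of the members of `V` at an edge, as a linear functional. -/
def evalV {n : ℕ} (V : Submodule (ZMod 2) (Kvecsp n)) (e : Edge n) : V →ₗ[ZMod 2] ZMod 2 :=
  (LinearMap.proj e).comp V.subtype

/-- Two functionals on a three-dimensional space have a common nonzero kernel vector. -/
lemma exists_common {n : ℕ} (V : Submodule (ZMod 2) (Kvecsp n))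
    (hdim : Module.finrank (ZMod 2) V = 3) (f g : V →ₗ[ZMod 2] ZMod 2) :
    ∃ v : V, v ≠ 0 ∧ f v = 0 ∧ g v = 0 := by
  have h : LinearMap.ker (f.prod g) ≠ ⊥ := by
    apply LinearMap.ker_ne_bot_of_finrank_lt
    rw [hdim, Module.finrank_prod, Module.finrank_self]
    norm_num
  obtain ⟨v, hv, hv0⟩ := Submodule.exists_mem_ne_zero_of_ne_bot h
  refine ⟨v, hv0, ?_⟩
  simpa using hv

/-- No nonzero member of `V` vanishes on all edges of a triangle. -/
lemma no_tri {n : ℕ} (V : Submodule (ZMod 2) (Kvecsp n))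
    (htf : ∀ v ∈ V, v ≠ 0 → TriangleFree (Kcompl v)) (v : V) (hv : v ≠ 0)
    (x y z : Fin n) (hxy : x ≠ y) (hxz : x ≠ z) (hyz : y ≠ z)
    (h1 : evalV V (edg x y hxy) v = 0) (h2 : evalV V (edg x z hxz) v = 0)
    (h3 : evalV V (edg y z hyz) v = 0) : False := by
  refine htf v.1 v.2 (by simpa using hv) ⟨x, y, z, hxy, hxz, hyz, ⟨hxy, ?_⟩, ⟨hxz, ?_⟩, ⟨hyz, ?_⟩⟩
  · simpa [evalV, Kcompl] using h1
  · simpa [evalV, Kcompl] using h2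
  · simpa [evalV, Kcompl] using h3

/-- If there is a three-dimensional subspace of the space of graphs on `n` vertices all of
whose nonzero elements have triangle-free complement, then `n ≤ 8`. -/
theorem stmt4 (n : ℕ) (V : Submodule (ZMod 2) (Kvecsp n))
    (hdim : Module.finrank (ZMod 2) V = 3)
    (htf : ∀ v ∈ V, v ≠ 0 → TriangleFree (Kcompl v)) :
    n ≤ 8 := by
  by_contra hn
  push Not at hn
  let o : Fin n := ⟨0, by omega⟩
  let L : Fin n → Module.Dual (ZMod 2) V := fun w =>
    if h : o ≠ w then evalV V (edg o w h) else 0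
  have hL : ∀ w (h : o ≠ w), L w = evalV V (edg o w h) := fun w h => dif_pos h
  have hL0 : L o = 0 := dif_neg (by simp)
  have hne : ∀ w, o ≠ w → L w ≠ 0 := by
    intro w h h0
    obtain ⟨z, hz⟩ : ∃ z : Fin n, z ∉ ({o, w} : Finset (Fin n)) := by
      by_contra hcon
      push Not at hcon
      have h1 : (Finset.univ : Finset (Fin n)) ⊆ {o, w} := fun z _ => hcon z
      have h2 := Finset.card_le_card h1
      have h3 := Finset.card_le_two (a := o) (b := w)
      simp only [Finset.card_univ, Fintype.card_fin] at h2
      omega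
    simp only [Finset.mem_insert, Finset.mem_singleton, not_or] at hz
    obtain ⟨v, hv, h1, h2⟩ := exists_common V hdim
      (evalV V (edg o z (Ne.symm hz.1))) (evalV V (edg w z (Ne.symm hz.2)))
    refine no_tri V htf v hv o w z h (Ne.symm hz.1) (Ne.symm hz.2) ?_ h1 h2
    rw [← hL w h, h0]
    rfl
  have hinj : Function.Injective L := by
    intro w w' h
    by_contra hww
    by_cases hw : o = w
    · subst hw
      exact hne w' hww (by rw [← h, hL0])
    by_cases hw' : o = w'
    · subst hw'
      exact hne w hw (by rw [h, hL0])
    obtain ⟨v, hv, h1, h2⟩ := exists_common V hdim (L w) (evalV V (edg w w' hww))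
    refine no_tri V htf v hv o w w' hw hw' hww ?_ ?_ h2
    · rw [← hL w hw]; exact h1
    · rw [← hL w' hw', ← h]; exact h1
  have hfin : Finite (Module.Dual (ZMod 2) V) := Module.finite_of_finite (ZMod 2)
  have hc := Nat.card_le_card_of_injective L hinj
  rw [Module.natCard_eq_pow_finrank (K := ZMod 2) (V := Module.Dual (ZMod 2) V), Subspace.dual_finrank_eq, hdim] at hc
  simp at hc
  omega
end

section
/- Suppose there exists a subset V of the ZZ_2-vector space of graphs on n vertices which is useful for triangles. Then every triangle-agreeing family of graphs on n vertices has size at most 2^(binomial(n,2) − 3). -/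
/-- A subset `V` of the space of graphs on `n` vertices, of size `2^m` for some `m ≥ 3`,
is useful for triangles if every subset of `V` of size `2^(m-3) + 1` contains two distinct
vectors whose agreement is triangle-free. -/
def UsefulForTriangles {n : ℕ} (V : Set (Kvecsp n)) : Prop :=
  ∃ m : ℕ, 3 ≤ m ∧ V.ncard = 2 ^ m ∧
    ∀ S ⊆ V, S.ncard = 2 ^ (m - 3) + 1 →
      ∃ G₁ ∈ S, ∃ G₂ ∈ S, G₁ ≠ G₂ ∧ TriangleFree (agr G₁ G₂)
/-- A family of graphs is triangle-agreeing if the agreement of any two members contains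
a triangle. -/
def TriangleAgreeing {n : ℕ} (F : Finset (Kvecsp n)) : Prop :=
  ∀ G₁ ∈ F, ∀ G₂ ∈ F, HasTriangle (agr G₁ G₂)

theorem agr_translate {n : ℕ} (x G₁ G₂ : Kvecsp n) : agr (G₁ + x) (G₂ + x) = agr G₁ G₂ := by
  funext e
  have h : x e + x e = 0 := CharTwo.add_self_eq_zero _
  simp only [agr, Pi.add_apply]
  linear_combination h

theorem card_Kvecsp (n : ℕ) : Fintype.card (Kvecsp n) = 2 ^ n.choose 2 := by
  rw [Fintype.card_fun, ZMod.card, Sym2.card_subtype_not_diag, Fintype.card_fin]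

/-- If some subset of the space of graphs on `n` vertices is useful for triangles, then
every triangle-agreeing family on `n` vertices has size at most `2^(C(n,2)-3)`. -/
theorem stmt5 (n : ℕ) (hV : ∃ V : Set (Kvecsp n), UsefulForTriangles V)
    (F : Finset (Kvecsp n)) (hF : TriangleAgreeing F) :
    F.card ≤ 2 ^ (n.choose 2 - 3) := by
  classical
  obtain ⟨V, m, hm, hcard, hS⟩ := hV
  obtain ⟨W, rfl⟩ : ∃ W : Finset (Kvecsp n), (W : Set (Kvecsp n)) = V :=
    ⟨V.toFinite.toFinset, by simp⟩
  rw [Set.ncard_coe_finset] at hcard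
  have hC : m ≤ n.choose 2 := by
    have h := Finset.card_le_univ W
    rw [hcard, card_Kvecsp] at h
    exact (Nat.pow_le_pow_iff_right (by norm_num)).1 h
  have key : ∀ x : Kvecsp n, (W.filter (fun v => v + x ∈ F)).card ≤ 2 ^ (m - 3) := by
    intro x
    by_contra hlt
    obtain ⟨S, hSW, hSc⟩ := Finset.exists_subset_card_eq (Nat.succ_le_of_lt (not_le.1 hlt))
    obtain ⟨a, ha, b, hb, -, hab⟩ := hS (S : Set (Kvecsp n))
      (fun y hy => (Finset.mem_filter.1 (hSW hy)).1) (by rw [Set.ncard_coe_finset, hSc])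
    apply hab
    rw [← agr_translate x]
    exact hF _ (Finset.mem_filter.1 (hSW ha)).2 _ (Finset.mem_filter.1 (hSW hb)).2
  have hcount : ∑ x : Kvecsp n, (W.filter (fun v => v + x ∈ F)).card = W.card * F.card := by
    simp only [Finset.card_filter]
    rw [Finset.sum_comm, ← smul_eq_mul, ← Finset.sum_const]
    refine Finset.sum_congr rfl fun v _ => ?_
    rw [← Equiv.sum_comp (Equiv.addLeft (-v))]
    simp
  have hle : W.card * F.card ≤ 2 ^ n.choose 2 * 2 ^ (m - 3) := by
    rw [← hcount, ← card_Kvecsp, ← smul_eq_mul, ← Finset.card_univ, ← Finset.sum_const]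
    exact Finset.sum_le_sum fun x _ => key x
  rw [hcard] at hle
  have e : 2 ^ n.choose 2 * 2 ^ (m - 3) = 2 ^ m * 2 ^ (n.choose 2 - 3) := by
    rw [← pow_add, ← pow_add]
    congr 1
    omega
  rw [e] at hle
  exact Nat.le_of_mul_le_mul_left hle (by positivity)
end

section
/- For every m ≥ 3 there exists a constant N_m such that: if V is a subset of the ZZ_2-vector space of graphs on n vertices which is useful for triangles and |V| ≤ 2^m, then n ≤ N_m. -/
/-- Multicolour Ramsey theorem for triangles. -/
theorem ramsey_triangle (k : ℕ) : ∃ N : ℕ, ∀ (α C : Type) (s : Finset α) (K : Finset C)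
    (c : α → α → C), K.card ≤ k → N ≤ s.card →
    (∀ x ∈ s, ∀ y ∈ s, x ≠ y → c x y ∈ K) →
    ∃ u v w : α, u ≠ v ∧ u ≠ w ∧ v ≠ w ∧ c u v = c u w ∧ c u v = c v w := by
  classical
  induction k with
  | zero =>
    refine ⟨2, fun α C s K c hK hs h => ?_⟩
    obtain ⟨x, hx, y, hy, hxy⟩ := Finset.one_lt_card.mp (show 1 < s.card by omega)
    have := h x hx y hy hxy
    rw [Finset.card_eq_zero.mp (Nat.le_zero.mp hK)] at this
    simp at this
  | succ k ih =>
    obtain ⟨N, hN⟩ := ih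
    refine ⟨(k + 1) * N + 2, fun α C s K c hK hs h => ?_⟩
    obtain ⟨v, hv⟩ := Finset.card_pos.mp (show 0 < s.card by omega)
    have hcard := Finset.card_erase_of_mem hv
    have hlt : K.card * N < (s.erase v).card := by
      have : K.card * N ≤ (k + 1) * N := Nat.mul_le_mul_right _ hK
      omega
    obtain ⟨a, ha, hT⟩ := Finset.exists_lt_card_fiber_of_mul_lt_card_of_maps_to
      (s := s.erase v) (t := K) (f := fun x => c v x)
      (fun x hx => h v hv x (Finset.mem_of_mem_erase hx) (Finset.ne_of_mem_erase hx).symm) hlt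
    by_cases hex : ∃ x ∈ (s.erase v).filter (fun x => c v x = a),
        ∃ y ∈ (s.erase v).filter (fun x => c v x = a), x ≠ y ∧ c x y = a
    · obtain ⟨x, hx, y, hy, hxy, hc⟩ := hex
      simp only [Finset.mem_filter, Finset.mem_erase] at hx hy
      exact ⟨v, x, y, hx.1.1.symm, hy.1.1.symm, hxy, by rw [hx.2, hy.2], by rw [hx.2, hc]⟩
    · push Not at hex
      refine hN α C _ (K.erase a) c ?_ hT.le ?_
      · rw [Finset.card_erase_of_mem ha]; omega
      · intro x hx y hy hxy
        refine Finset.mem_erase.mpr ⟨hex x hx y hy hxy, ?_⟩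
        simp only [Finset.mem_filter, Finset.mem_erase] at hx hy
        exact h x hx.1.2 y hy.1.2 hxy

/-- Two graphs with the same constant value on a triangle agree on a triangle. -/
theorem agr_hasTriangle {n : ℕ} {G H : Kvecsp n} {u v w : Fin n} (huv : u ≠ v) (huw : u ≠ w)
    (hvw : v ≠ w) (hG1 : G (edg u v huv) = G (edg u w huw))
    (hG2 : G (edg u v huv) = G (edg v w hvw)) (hH1 : H (edg u v huv) = H (edg u w huw))
    (hH2 : H (edg u v huv) = H (edg v w hvw)) (hGH : G (edg u v huv) = H (edg u v huv)) :
    HasTriangle (agr G H) := by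
  have key : ∀ a : ZMod 2, a + a + 1 = 1 := by decide
  refine ⟨u, v, w, huv, huw, hvw, ⟨huv, ?_⟩, ⟨huw, ?_⟩, ⟨hvw, ?_⟩⟩ <;> unfold agr
  · rw [hGH]; exact key _
  · rw [← hG1, ← hH1, hGH]; exact key _
  · rw [← hG2, ← hH2, hGH]; exact key _

/-- For every `m ≥ 3` there is a constant `N` such that any subset of the space of graphs
on `n` vertices which is useful for triangles and has size at most `2^m` forces `n ≤ N`. -/
theorem stmt6 (m : ℕ) (hm : 3 ≤ m) :
    ∃ N : ℕ, ∀ (n : ℕ) (V : Set (Kvecsp n)),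
      UsefulForTriangles V → V.ncard ≤ 2 ^ m → n ≤ N := by
  classical
  obtain ⟨N, hN⟩ := ramsey_triangle (2 ^ 2 ^ m)
  refine ⟨N, fun n V hV hVm => ?_⟩
  by_contra hn
  obtain ⟨m', hm', hcard, hS⟩ := hV
  have hfin : V.Finite := Set.toFinite V
  have hC : Fintype.card (V → ZMod 2) ≤ 2 ^ 2 ^ m := by
    rw [Fintype.card_fun, ZMod.card]
    refine Nat.pow_le_pow_right (by norm_num) ?_
    rwa [← Nat.card_eq_fintype_card, Nat.card_coe_set_eq]
  obtain ⟨u, v, w, huv, huw, hvw, h1, h2⟩ := hN (Fin n) (V → ZMod 2) Finset.univ Finset.univ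
    (fun u v G => if h : u ≠ v then G.1 (edg u v h) else 0) hC
    (by rw [Finset.card_univ, Fintype.card_fin]; omega) (fun _ _ _ _ _ => Finset.mem_univ _)
  have e1 : ∀ G ∈ V, G (edg u v huv) = G (edg u w huw) := fun G hG => by
    have := congrFun h1 ⟨G, hG⟩
    simpa [huv, huw] using this
  have e2 : ∀ G ∈ V, G (edg u v huv) = G (edg v w hvw) := fun G hG => by
    have := congrFun h2 ⟨G, hG⟩
    simpa [huv, hvw] using this
  have hVc : hfin.toFinset.card = 2 ^ m' := by
    rw [← Set.ncard_eq_toFinset_card V hfin, hcard]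
  have hlt : (Finset.univ : Finset (ZMod 2)).card * 2 ^ (m' - 3) < hfin.toFinset.card := by
    rw [hVc, Finset.card_univ, ZMod.card]
    obtain ⟨j, rfl⟩ := Nat.exists_eq_add_of_le hm'
    have : 0 < 2 ^ j := by positivity
    rw [Nat.add_sub_cancel_left, pow_add]
    omega
  obtain ⟨a, -, hT⟩ := Finset.exists_lt_card_fiber_of_mul_lt_card_of_maps_to
    (s := hfin.toFinset) (t := (Finset.univ : Finset (ZMod 2)))
    (f := fun G => G (edg u v huv)) (fun _ _ => Finset.mem_univ _) hlt
  obtain ⟨S, hSs, hSc⟩ := Finset.exists_subset_card_eq (Nat.succ_le_of_lt hT)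
  have hmem : ∀ G ∈ S, G ∈ V ∧ G (edg u v huv) = a := fun G hG => by
    have := hSs hG
    simpa using this
  obtain ⟨G, hG, H, hH, -, hfree⟩ := hS (S : Set (Kvecsp n)) (fun G hG => (hmem G hG).1)
    (by rw [Set.ncard_coe_finset, hSc])
  obtain ⟨hGV, hGa⟩ := hmem G hG
  obtain ⟨hHV, hHa⟩ := hmem H hH
  exact hfree (agr_hasTriangle huv huw hvw (e1 G hGV) (e2 G hGV) (e1 H hHV) (e2 H hHV)
    (hGa.trans hHa.symm))
end

section
/- Suppose S is a subset of the ZZ_2-vector space of graphs on n vertices which is useful for triangles. Then the linear span of S (over ZZ_2) is also useful for triangles. -/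
theorem agr_add_right {n : ℕ} (x y w : Kvecsp n) : agr (x + w) (y + w) = agr x y := by
  funext e
  have h : w e + w e = 0 := CharTwo.add_self_eq_zero _
  simp only [agr, Pi.add_apply]
  linear_combination h

/-- If a subset of the space of graphs on `n` vertices is useful for triangles, then so is
its linear span over `ZZ_2`. -/
theorem stmt7 (n : ℕ) (S : Set (Kvecsp n)) (hS : UsefulForTriangles S) :
    UsefulForTriangles (↑(Submodule.span (ZMod 2) S) : Set (Kvecsp n)) := by
  classical
  obtain ⟨m, hm, hcard, hu⟩ := hS
  set W := Submodule.span (ZMod 2) S with hW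
  have hWc : (W : Set (Kvecsp n)).ncard = 2 ^ Module.finrank (ZMod 2) W := by
    have := Module.natCard_eq_pow_finrank (K := ZMod 2) (V := W)
    rw [Nat.card_zmod] at this
    exact this
  have hSW : S ⊆ W := Submodule.subset_span
  have hle : 2 ^ m ≤ 2 ^ Module.finrank (ZMod 2) W := by
    rw [← hcard, ← hWc]
    exact Set.ncard_le_ncard hSW (Set.toFinite _)
  have hk : m ≤ Module.finrank (ZMod 2) W := (Nat.pow_le_pow_iff_right (by norm_num)).mp hle
  generalize Module.finrank (ZMod 2) W = k at *
  refine ⟨k, hm.trans hk, hWc, ?_⟩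
  intro T hT hTc
  by_contra hbad
  push Not at hbad
  have hA : ∀ w ∈ (W : Set (Kvecsp n)).toFinset,
      (S.toFinset.filter (fun s => s + w ∈ T)).card ≤ 2 ^ (m - 3) := by
    intro w _
    by_contra hlt
    push Not at hlt
    obtain ⟨B, hB, hBc⟩ := Finset.exists_subset_card_eq (Nat.succ_le_of_lt hlt)
    have hmem : ∀ x ∈ B, x ∈ S ∧ x + w ∈ T := fun x hx => by simpa using hB hx
    obtain ⟨x, hx, y, hy, hne, htf⟩ := hu (B : Set (Kvecsp n)) (fun x hx => (hmem x hx).1)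
      (by rw [Set.ncard_coe_finset, hBc])
    refine hbad _ (hmem x hx).2 _ (hmem y hy).2 (fun h => hne (add_right_cancel h)) ?_
    rwa [agr_add_right]
  have hB : ∀ s ∈ S.toFinset,
      ((W : Set (Kvecsp n)).toFinset.filter (fun w => s + w ∈ T)).card = 2 ^ (k - 3) + 1 := by
    intro s hs
    rw [← hTc, Set.ncard_eq_toFinset_card']
    refine Finset.card_bij (fun w _ => s + w) ?_ ?_ ?_
    · intro w hw
      simpa using (Finset.mem_filter.mp hw).2
    · intro a _ b _ h
      exact add_left_cancel h
    · intro t ht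
      have ht' : t ∈ T := by simpa using ht
      have hs' : s ∈ W := hSW (by simpa using hs)
      refine ⟨t - s, ?_, by abel⟩
      rw [Finset.mem_filter, Set.mem_toFinset]
      exact ⟨W.sub_mem (hT ht') hs', by simpa using ht'⟩
  have hd := Finset.sum_card_bipartiteAbove_eq_sum_card_bipartiteBelow
    (s := S.toFinset) (t := (W : Set (Kvecsp n)).toFinset) (fun s w => s + w ∈ T)
  unfold Finset.bipartiteAbove Finset.bipartiteBelow at hd
  rw [Finset.sum_congr rfl hB, Finset.sum_const, smul_eq_mul] at hd
  have h2 := Finset.sum_le_card_nsmul _ _ _ hA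
  rw [← hd, smul_eq_mul, ← Set.ncard_eq_toFinset_card', ← Set.ncard_eq_toFinset_card', hcard,
    hWc] at h2
  obtain ⟨a, rfl⟩ := Nat.exists_eq_add_of_le hm
  obtain ⟨b, rfl⟩ := Nat.exists_eq_add_of_le (hm.trans hk)
  simp only [Nat.add_sub_cancel_left, pow_add] at h2
  have hp : 0 < 2 ^ a := by positivity
  nlinarith
end

section
/- Let F be a family of graphs on n vertices that is monotone (i.e., if G ∈ F and G ⊆ H then H ∈ F) and non-bipartite-agreeing. Then F is non-bipartite-intersecting, i.e., for any two graphs G1, G2 ∈ F the intersection G1 ∩ G2 is not bipartite. -/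
/-- The intersection (as edge sets) of two graphs. -/
def Kinter {n : ℕ} (G₁ G₂ : Kvecsp n) : Kvecsp n := fun e => G₁ e * G₂ e

/-- A monotone non-bipartite-agreeing family of graphs is non-bipartite-intersecting. -/
theorem stmt16 (n : ℕ) (F : Set (Kvecsp n))
    (hmono : ∀ G ∈ F, ∀ H : Kvecsp n, (∀ e, G e = 1 → H e = 1) → H ∈ F)
    (hagr : ∀ G₁ ∈ F, ∀ G₂ ∈ F, ¬ IsBipartite (agr G₁ G₂)) :
    ∀ G₁ ∈ F, ∀ G₂ ∈ F, ¬ IsBipartite (Kinter G₁ G₂) := by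
  intro G₁ h₁ G₂ h₂ hb
  have hH : (fun e => G₁ e + 1 + G₁ e * G₂ e) ∈ F := by
    refine hmono G₂ h₂ _ fun e he => ?_
    have key : ∀ a : ZMod 2, a + 1 + a * 1 = 1 := by decide
    simp only [he]
    exact key _
  refine hagr G₁ h₁ _ hH ?_
  have heq : agr G₁ (fun e => G₁ e + 1 + G₁ e * G₂ e) = Kinter G₁ G₂ := by
    funext e
    have key : ∀ a b : ZMod 2, a + (a + 1 + a * b) + 1 = a * b := by decide
    exact key _ _
  rw [heq]
  exact hb
end
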